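/- arXiv:2604.03965 — 3 statements merged into one kernel-verified Lean document; each statement's English description precedes it below -/
import Mathlib

section
/- Let V be a complex Banach space with an injective linear map ι into the entire functions on ℂ^d satisfying the continuous-inclusion bounds. Let f : ℂ^d → ℂ^d be holomorphic, u : ℂ^d → ℂ entire, and suppose the weighted composition operator uC_f is bounded on V. Let p ∈ ℂ^d be a periodic point of f of period r ≥ 1 (i.e. f^{∘r}(p) = p) with u_r(p) ≠ 0, and suppose Assumption (I) holds for (V, f^{∘r}, u_r, p). Then every eigenvalue α of the Fréchet derivative D(f^{∘r})(p) (a ℂ-linear endomorphism of ℂ^d) satisfies |α| ≤ 1. -/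
open Filter Topology Asymptotics

section Holomorphic

variable {E F : Type*} [NormedAddCommGroup E] [NormedSpace ℂ E] [FiniteDimensional ℂ E]
  [NormedAddCommGroup F] [NormedSpace ℂ F]

/-- Cauchy estimate: the derivative of an entire function is bounded on balls. -/
lemma Differentiable.exists_norm_fderiv_le_closedBall {f : E → F} (hf : Differentiable ℂ f)
    (z : E) (R : ℝ) : ∃ M, ∀ y ∈ Metric.closedBall z R, ‖fderiv ℂ f y‖ ≤ M := by
  have : ProperSpace E := FiniteDimensional.proper ℂ E
  obtain ⟨M, hM⟩ := (isCompact_closedBall z (R + 1)).exists_bound_of_continuousOn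
    hf.continuous.continuousOn
  refine ⟨max M 0, fun y hy => ContinuousLinearMap.opNorm_le_of_unit_norm (𝕜 := ℝ)
    (f := (fderiv ℂ f y).restrictScalars ℝ) (le_max_right _ _) fun v hv => ?_⟩
  have hline : HasDerivAt (fun t : ℂ => f (y + t • v)) (fderiv ℂ f y v) 0 := by
    have h1 : HasDerivAt (fun t : ℂ => y + t • v) v 0 := by
      simpa using ((hasDerivAt_id (0 : ℂ)).smul_const v).const_add y
    have h2 : HasFDerivAt f (fderiv ℂ f y) (y + (0 : ℂ) • v) := by
      simpa using (hf y).hasFDerivAt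
    exact h2.comp_hasDerivAt (0 : ℂ) h1
  have hdiff : Differentiable ℂ fun t : ℂ => f (y + t • v) := by fun_prop
  have := Complex.norm_deriv_le_of_forall_mem_sphere_norm_le (c := 0) (C := M) one_pos
    hdiff.diffContOnCl fun t ht => hM _ ?_
  · rw [hline.deriv, div_one] at this
    exact this.trans (le_max_left _ _)
  · have ht' : ‖t‖ = 1 := by simpa using ht
    rw [Metric.mem_closedBall, dist_eq_norm] at hy ⊢
    calc ‖y + t • v - z‖ = ‖(y - z) + t • v‖ := by congr 1; abel
      _ ≤ ‖y - z‖ + ‖t • v‖ := norm_add_le _ _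
      _ ≤ R + 1 := by rw [norm_smul, ht', hv]; linarith

/-- Directional derivatives of an entire function of several variables are entire. -/
lemma Differentiable.fderiv_apply_of_finiteDimensional [FiniteDimensional ℂ F] {f : E → F}
    (hf : Differentiable ℂ f) (v : E) : Differentiable ℂ fun z => fderiv ℂ f z v := by
  have : CompleteSpace F := FiniteDimensional.complete ℂ F
  let c : ℝ → ℂ := fun θ => circleMap 0 1 θ
  have hc : Continuous c := continuous_circleMap 0 1
  have hc1 : ∀ θ, ‖c θ‖ = 1 := fun θ => by simp [c]
  let k : ℝ → ℂ := fun θ => _root_.deriv (circleMap 0 1) θ * ((c θ - 0) ^ 2)⁻¹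
  have hk : Continuous k := by
    have : k = fun θ => c θ * Complex.I * ((c θ - 0) ^ 2)⁻¹ := by
      funext θ; simp [k, c, deriv_circleMap]
    rw [this]
    refine (hc.mul continuous_const).mul (Continuous.inv₀ (by fun_prop) fun θ => ?_)
    have : c θ ≠ 0 := by rw [← norm_pos_iff, hc1]; exact one_pos
    simpa using this
  have hformula : (fun z => fderiv ℂ f z v) = fun z =>
      (2 * Real.pi * Complex.I : ℂ)⁻¹ • ∫ θ in (0 : ℝ)..2 * Real.pi, k θ • f (z + c θ • v) := by
    funext z
    have hdiff : Differentiable ℂ fun t : ℂ => f (z + t • v) := by fun_prop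
    have hline : HasDerivAt (fun t : ℂ => f (z + t • v)) (fderiv ℂ f z v) 0 := by
      have h1 : HasDerivAt (fun t : ℂ => z + t • v) v 0 := by
        simpa using ((hasDerivAt_id (0 : ℂ)).smul_const v).const_add z
      have h2 : HasFDerivAt f (fderiv ℂ f z) (z + (0 : ℂ) • v) := by
        simpa using (hf z).hasFDerivAt
      exact h2.comp_hasDerivAt (0 : ℂ) h1
    have := Complex.cderiv_eq_deriv isOpen_univ hdiff.differentiableOn one_pos
      (Set.subset_univ (Metric.closedBall 0 1))
    rw [← hline.deriv, ← this, Complex.cderiv, circleIntegral]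
    simp only [smul_smul, k, c]
  rw [hformula]
  refine Differentiable.const_smul (fun z₀ => ?_) _
  obtain ⟨M, hM⟩ := hf.exists_norm_fderiv_le_closedBall z₀ (1 + ‖v‖)
  have : ProperSpace (E →L[ℂ] F) := FiniteDimensional.proper ℂ _
  borelize E
  borelize (E →L[ℂ] F)
  refine (intervalIntegral.hasFDerivAt_integral_of_dominated_of_fderiv_le
    (F' := fun z θ => k θ • fderiv ℂ f (z + c θ • v)) (bound := fun θ => ‖k θ‖ * M)
    (Metric.ball_mem_nhds z₀ one_pos) ?_ ?_ ?_ ?_ ?_ ?_).differentiableAt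
  · refine Eventually.of_forall fun z => Continuous.aestronglyMeasurable ?_
    have := hf.continuous
    fun_prop
  · refine Continuous.intervalIntegrable ?_ _ _
    have := hf.continuous
    fun_prop
  · have hline : Continuous fun θ => z₀ + c θ • v := by fun_prop
    exact (hk.measurable.smul
      ((measurable_fderiv ℂ f).comp hline.measurable)).aestronglyMeasurable
  · refine Eventually.of_forall fun θ _ z hz => ?_
    rw [norm_smul]
    refine mul_le_mul_of_nonneg_left (hM _ ?_) (norm_nonneg _)
    rw [Metric.mem_ball, dist_eq_norm] at hz
    rw [Metric.mem_closedBall, dist_eq_norm]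
    calc ‖z + c θ • v - z₀‖ = ‖(z - z₀) + c θ • v‖ := by congr 1; abel
      _ ≤ ‖z - z₀‖ + ‖c θ • v‖ := norm_add_le _ _
      _ ≤ 1 + ‖v‖ := by rw [norm_smul, hc1, one_mul]; linarith
  · exact (hk.norm.mul continuous_const).intervalIntegrable _ _
  · refine Eventually.of_forall fun θ _ z _ => HasFDerivAt.const_smul ?_ (k θ)
    exact (hasFDerivAt_comp_add_right (c θ • v)).2 (hf _).hasFDerivAt

/-- An entire function on a finite-dimensional space is smooth. -/
lemma Differentiable.contDiff_of_finiteDimensional [FiniteDimensional ℂ F] {f : E → F}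
    (hf : Differentiable ℂ f) (n : ℕ) : ContDiff ℂ n f := by
  induction n generalizing f with
  | zero => simpa using hf.continuous
  | succ n ih =>
    push_cast
    refine contDiff_succ_iff_fderiv_apply.2 ⟨hf, by simp, fun y => ?_⟩
    exact ih (hf.fderiv_apply_of_finiteDimensional y)

end Holomorphic

/-- A `C^n` function whose derivatives up to order `n` vanish at `p` is `o(‖z - p‖ ^ n)`. -/
lemma ContDiff.isLittleO_of_iteratedFDeriv_eq_zero.{v} {E F : Type v}
    [NormedAddCommGroup E] [NormedSpace ℂ E] [NormedAddCommGroup F] [NormedSpace ℂ F]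
    {g : E → F} {p : E} {n : ℕ} (hg : ContDiff ℂ n g)
    (h0 : ∀ k < n + 1, iteratedFDeriv ℂ k g p = 0) :
    g =o[𝓝 p] fun z => ‖z - p‖ ^ n := by
  have hgp : g p = 0 := by
    rw [← norm_eq_zero, ← norm_iteratedFDeriv_zero (𝕜 := ℂ), h0 0 (by omega), norm_zero]
  induction n generalizing F with
  | zero =>
    simp only [pow_zero, isLittleO_one_iff]
    simpa [hgp] using hg.continuous.tendsto p
  | succ n ih =>
    push_cast at hg
    obtain ⟨hd, -, hg'⟩ := contDiff_succ_iff_fderiv.1 hg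
    have h1 : ∀ k < n + 1, iteratedFDeriv ℂ k (fderiv ℂ g) p = 0 := fun k hk => by
      rw [← norm_eq_zero, norm_iteratedFDeriv_fderiv, h0 _ (by omega), norm_zero]
    have h2 : fderiv ℂ g p = 0 := by
      rw [← norm_eq_zero, ← norm_iteratedFDeriv_zero (𝕜 := ℂ), h1 0 (by omega), norm_zero]
    have key := ih hg' h1 h2
    rw [isLittleO_iff] at key ⊢
    intro ε hε
    obtain ⟨δ, hδ, hball⟩ := Metric.eventually_nhds_iff_ball.1 (key hε)
    filter_upwards [Metric.ball_mem_nhds p hδ] with z hz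
    have hz' : ‖z - p‖ < δ := by simpa [dist_eq_norm] using hz
    have := (convex_closedBall p ‖z - p‖).norm_image_sub_le_of_norm_fderiv_le (𝕜 := ℂ) (f := g)
      (C := ε * ‖z - p‖ ^ n) (x := p) (y := z) (fun x _ => hd x) (fun x hx => ?_) (by simp)
      (by simp [dist_eq_norm])
    · rw [hgp, sub_zero] at this
      simpa [pow_succ, mul_assoc] using this
    · rw [Metric.mem_closedBall, dist_eq_norm] at hx
      refine (hball x (by rw [Metric.mem_ball, dist_eq_norm]; linarith)).trans ?_
      rw [norm_pow, norm_norm]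
      gcongr

/-- The powers of a linear functional vanish to the expected order at the zero of the functional. -/
lemma iteratedFDeriv_clm_sub_pow_eq_zero {E : Type*} [NormedAddCommGroup E] [NormedSpace ℂ E]
    (l : E →L[ℂ] ℂ) (p : E) {n k : ℕ} (hk : k < n) :
    iteratedFDeriv ℂ k (fun z => l (z - p) ^ n) p = 0 := by
  have h1 := iteratedFDeriv_comp_sub (𝕜 := ℂ) (f := fun z => l z ^ n) k p p
  have h2 := l.iteratedFDeriv_comp_right (f := fun t : ℂ => t ^ n) (n := k) (by fun_prop)
    (p - p) le_rfl
  have h3 : iteratedFDeriv ℂ k (fun t : ℂ => t ^ n) 0 = 0 := by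
    rw [← norm_eq_zero, norm_iteratedFDeriv_eq_norm_iteratedDeriv, iteratedDeriv_pow,
      zero_pow (by omega)]
    simp
  rw [h1]
  refine h2.trans ?_
  rw [sub_self, map_zero, h3]
  rfl

/-- Perturbing the base of a power by lower-order terms perturbs the power by lower-order terms. -/
lemma Asymptotics.IsLittleO.pow_sub_pow {X : Type*} {L : Filter X} {a b : X → ℂ} {g : X → ℝ}
    (ha : a =O[L] g) (hab : (fun x => b x - a x) =o[L] g) (n : ℕ) :
    (fun x => b x ^ (n + 1) - a x ^ (n + 1)) =o[L] fun x => g x ^ (n + 1) := by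
  induction n with
  | zero => simpa using hab
  | succ n ih =>
    have hb : b =O[L] g := by simpa using hab.isBigO.add ha
    have h1 := ih.mul_isBigO hb
    have h2 := (ha.pow (n + 1)).mul_isLittleO hab
    refine (h1.add h2).congr (fun x => by ring) (fun x => by ring)

/-- A weighted composition operator fixing `p` multiplies a leading term `c * l ^ n`, where `l` is
a left eigenvector of the derivative with eigenvalue `α`, by the weight at `p` times `α ^ n`. -/
lemma weightedComp_leading_term {E : Type*} [NormedAddCommGroup E] [NormedSpace ℂ E]
    {G : E → E} {W g : E → ℂ} {p : E} (hG : DifferentiableAt ℂ G p) (hGp : G p = p)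
    (hW : ContinuousAt W p) (l : E →L[ℂ] ℂ) {α : ℂ}
    (hl : ∀ x, l (fderiv ℂ G p x) = α * l x) {n : ℕ} (hn : 1 ≤ n) {c : ℂ}
    (hg : (fun z => g z - c * l (z - p) ^ n) =o[𝓝 p] fun z => ‖z - p‖ ^ n) :
    (fun z => W z * g (G z) - W p * α ^ n * c * l (z - p) ^ n) =o[𝓝 p]
      fun z => ‖z - p‖ ^ n := by
  obtain ⟨m, rfl⟩ : ∃ m, n = m + 1 := ⟨n - 1, by omega⟩
  have hGt : Tendsto G (𝓝 p) (𝓝 p) := by simpa [hGp] using hG.continuousAt.tendsto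
  have hO : (fun z => G z - p) =O[𝓝 p] fun z => ‖z - p‖ := by
    simpa [hGp] using hG.hasFDerivAt.isBigO_sub.norm_right
  have hlO : (fun z => l (z - p)) =O[𝓝 p] fun z => ‖z - p‖ :=
    (l.isBigO_comp (fun z => z - p) (𝓝 p)).norm_right
  have h1 : (fun z => g (G z) - c * l (G z - p) ^ (m + 1)) =o[𝓝 p]
      fun z => ‖z - p‖ ^ (m + 1) :=
    (hg.comp_tendsto hGt).trans_isBigO (hO.norm_left.pow (m + 1))
  have h2 : (fun z => l (G z - p) - α * l (z - p)) =o[𝓝 p] fun z => ‖z - p‖ := by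
    have := (l.isBigO_comp _ (𝓝 p)).trans_isLittleO hG.hasFDerivAt.isLittleO
    refine this.norm_right.congr_left fun z => ?_
    rw [map_sub, hl, hGp]
  have h3 := IsLittleO.pow_sub_pow (hlO.const_mul_left α) h2 m
  have h4 : (fun z => g (G z) - c * α ^ (m + 1) * l (z - p) ^ (m + 1)) =o[𝓝 p]
      fun z => ‖z - p‖ ^ (m + 1) :=
    (h1.add (h3.const_mul_left c)).congr_left fun z => by ring
  have h5 := (hW.tendsto.isBigO_one ℝ).mul_isLittleO h4
  have h6 : (fun z => W z - W p) =o[𝓝 p] fun _ => (1 : ℝ) := by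
    rw [isLittleO_one_iff]
    simpa using hW.tendsto.sub_const (W p)
  have h7 := h6.mul_isBigO ((hlO.pow (m + 1)).const_mul_left (c * α ^ (m + 1)))
  exact (h5.add h7).congr (fun z => by ring) fun z => by ring

/-- The coefficient of a leading term `c * l ^ n` is bounded by the supremum on a ball. -/
lemma norm_leading_coeff_le {E : Type*} [NormedAddCommGroup E] [NormedSpace ℂ E]
    {g : E → ℂ} (hg : Differentiable ℂ g) {p w : E} {l : E →L[ℂ] ℂ} (hw : l w = 1) {n : ℕ}
    {c : ℂ} (hc : (fun z => g z - c * l (z - p) ^ n) =o[𝓝 p] fun z => ‖z - p‖ ^ n) {B : ℝ}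
    (hB : ∀ z ∈ Metric.closedBall p ‖w‖, ‖g z‖ ≤ B) : ‖c‖ ≤ B := by
  have hφ : Differentiable ℂ fun t : ℂ => g (p + t • w) := by fun_prop
  have ht : Tendsto (fun t : ℂ => p + t • w) (𝓝 0) (𝓝 p) := by
    have : Continuous fun t : ℂ => p + t • w := by fun_prop
    simpa using this.tendsto 0
  have h1 : (fun t : ℂ => g (p + t • w) - c * t ^ n) =o[𝓝 0] fun t : ℂ => t ^ n := by
    refine ((hc.comp_tendsto ht).congr_left (fun t => ?_)).trans_isBigO ?_
    · simp [hw]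
    · refine IsBigO.of_bound (‖w‖ ^ n) (Eventually.of_forall fun t => ?_)
      simp [norm_smul, mul_pow, mul_comm]
  let ψ : ℂ → ℂ := Function.update (fun t => g (p + t • w) / t ^ n) 0 c
  have hψne : ∀ t ≠ 0, ψ t = g (p + t • w) / t ^ n := fun t ht => by simp [ψ, ht]
  have hcont : ContinuousAt ψ 0 := by
    rw [continuousAt_update_same]
    have h2 := (h1.mono nhdsWithin_le_nhds).tendsto_div_nhds_zero (l := 𝓝[≠] (0 : ℂ))
    have h3 := h2.add_const c
    rw [zero_add] at h3
    refine h3.congr' ?_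
    filter_upwards [self_mem_nhdsWithin] with t ht
    have : t ^ n ≠ 0 := pow_ne_zero _ ht
    field_simp
    ring
  have hψ : DifferentiableOn ℂ ψ Set.univ := by
    refine (Complex.differentiableOn_compl_singleton_and_continuousAt_iff
      (c := 0) univ_mem).1 ⟨?_, hcont⟩
    refine DifferentiableOn.congr (f := fun t : ℂ => g (p + t • w) / t ^ n) ?_
      fun t ht => hψne t ht.2
    exact hφ.differentiableOn.div (by fun_prop) fun t ht => pow_ne_zero _ ht.2
  have := Complex.norm_le_of_forall_mem_frontier_norm_le (U := Metric.ball (0 : ℂ) 1)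
    Metric.isBounded_ball (differentiableOn_univ.1 hψ).diffContOnCl (C := B) (fun t ht => ?_)
    (z := 0) (subset_closure (by simp))
  · simpa [ψ] using this
  · rw [frontier_ball _ one_ne_zero] at ht
    have ht' : ‖t‖ = 1 := by simpa using ht
    rw [hψne t (by rw [← norm_pos_iff, ht']; exact one_pos), norm_div, norm_pow, ht', one_pow,
      div_one]
    exact hB _ (by simp [dist_eq_norm, norm_smul, ht'])

/-- An eigenvalue of an endomorphism of a finite-dimensional space has a left eigenvector,
normalized at some vector. -/
lemma exists_left_eigenvector {E : Type*} [NormedAddCommGroup E] [NormedSpace ℂ E]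
    [FiniteDimensional ℂ E] (A : E →L[ℂ] E) {α : ℂ} (hα : ∃ v : E, v ≠ 0 ∧ A v = α • v) :
    ∃ (l : E →L[ℂ] ℂ) (w : E), l w = 1 ∧ ∀ x, l (A x) = α * l x := by
  obtain ⟨v, hv, hAv⟩ := hα
  let B : E →ₗ[ℂ] E := A.toLinearMap - α • LinearMap.id
  have hB : LinearMap.range B < ⊤ := by
    rw [lt_top_iff_ne_top, Ne, LinearMap.range_eq_top, ← LinearMap.injective_iff_surjective]
    intro h
    exact hv (h (by simp [B, hAv]))
  obtain ⟨l, hl0, hl⟩ := Submodule.exists_le_ker_of_lt_top _ hB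
  obtain ⟨x, hx⟩ : ∃ x, l x ≠ 0 := by
    by_contra! h
    exact hl0 (LinearMap.ext h)
  refine ⟨LinearMap.toContinuousLinearMap l, (l x)⁻¹ • x, by simp [hx], fun y => ?_⟩
  have : l (B y) = 0 := hl ⟨y, rfl⟩
  simpa [B, sub_eq_zero] using this

/-- Iterates of a weighted composition operator are weighted composition operators. -/
lemma weightedComp_pow_apply {E V : Type*} [NormedAddCommGroup V] [NormedSpace ℂ V]
    (ι : V →ₗ[ℂ] (E → ℂ)) {f : E → E} {u : E → ℂ} {T : V →L[ℂ] V}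
    (hT : ∀ h : V, ι (T h) = fun z => u z * ι h (f z)) (m : ℕ) (h : V) :
    ι ((T ^ m) h) = fun z => (∏ j ∈ Finset.range m, u (f^[j] z)) * ι h (f^[m] z) := by
  induction m generalizing h with
  | zero => simp
  | succ m ih =>
    funext z
    rw [pow_succ, mul_apply_eq_comp, ih, hT, Finset.prod_range_succ,
      Function.iterate_succ_apply', mul_assoc]

lemma le_of_forall_pow_succ_le_mul_pow {a b M : ℝ} (hb : 0 ≤ b)
    (h : ∀ k : ℕ, a ^ (k + 1) ≤ M * b ^ k) : a ≤ b := by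
  by_contra! hab
  have ha : 0 < a := hb.trans_lt hab
  have ht : Tendsto (fun k : ℕ => M * (b / a) ^ k) atTop (𝓝 (M * 0)) :=
    (tendsto_pow_atTop_nhds_zero_of_lt_one (by positivity) ((div_lt_one ha).2 hab)).const_mul M
  refine ha.not_ge ((ge_of_tendsto' ht fun k => ?_).trans_eq (mul_zero M))
  rw [div_pow, ← mul_div_assoc, le_div_iff₀ (by positivity)]
  linarith [h k, pow_succ' a k]


/-- boundedness of a weighted composition operator on a Banach space of
entire functions on ℂ^d forces every eigenvalue of `D(f^[r]) p` at a periodic point `p`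
(with `u_r p ≠ 0` and Assumption (I)) to have modulus at most 1. -/
theorem bounded_weighted_composition_eigenvalue_le_one
    {d : ℕ} {V : Type*} [NormedAddCommGroup V] [NormedSpace ℂ V] [CompleteSpace V]
    (ι : V →ₗ[ℂ] ((Fin d → ℂ) → ℂ)) (hinj : Function.Injective ι)
    (hent : ∀ h : V, Differentiable ℂ (ι h))
    (hbd : ∀ K : Set (Fin d → ℂ), IsCompact K →
      ∃ C : ℝ, 0 ≤ C ∧ ∀ h : V, ∀ z ∈ K, ‖ι h z‖ ≤ C * ‖h‖)
    (f : (Fin d → ℂ) → (Fin d → ℂ)) (hf : Differentiable ℂ f)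
    (u : (Fin d → ℂ) → ℂ) (hu : Differentiable ℂ u)
    (T : V →L[ℂ] V) (hT : ∀ h : V, ι (T h) = fun z => u z * ι h (f z))
    (p : Fin d → ℂ) (r : ℕ) (hr : 1 ≤ r) (hp : f^[r] p = p)
    (hur : (∏ j ∈ Finset.range r, u (f^[j] p)) ≠ 0)
    (hI : {n : ℕ | 1 ≤ n ∧ ∀ h : (Fin d → ℂ) → ℂ, Differentiable ℂ h →
        (∀ k < n, iteratedFDeriv ℂ k h (f^[r] p) = 0) →
        ∃ v : V, ∀ k < n + 1,
          iteratedFDeriv ℂ k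
            (fun z => ι v z - (∏ j ∈ Finset.range r, u (f^[j] z)) * h (f^[r] z)) p = 0}.Infinite)
    (α : ℂ) (hα : ∃ v : Fin d → ℂ, v ≠ 0 ∧ fderiv ℂ (f^[r]) p v = α • v) :
    ‖α‖ ≤ 1 := by
  obtain ⟨l, w, hw, hl⟩ := exists_left_eigenvector _ hα
  have hfit : ∀ j, Differentiable ℂ f^[j] := fun j => hf.iterate j
  set W : (Fin d → ℂ) → ℂ := fun z => ∏ j ∈ Finset.range r, u (f^[j] z) with hWdef
  have hWdiff : Differentiable ℂ W := by
    have hufit : ∀ j, Differentiable ℂ fun z => u (f^[j] z) := fun j => hu.comp (hfit j)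
    exact fun z => (HasFDerivAt.finsetProd fun j _ =>
      (hufit j z).hasFDerivAt).differentiableAt
  obtain ⟨C, hC0, hC⟩ := hbd _ (isCompact_closedBall p ‖w‖)
  have hpow : ∀ k, ‖(T ^ r) ^ k‖ ≤ ‖T ^ r‖ ^ k := by
    intro k
    induction k with
    | zero => rw [pow_zero, pow_zero]; exact ContinuousLinearMap.norm_id_le
    | succ k ih =>
      rw [pow_succ, pow_succ]
      exact (norm_mul_le _ _).trans (by gcongr)
  have hbound : ∀ n : ℕ, 1 ≤ n → (∀ h : (Fin d → ℂ) → ℂ, Differentiable ℂ h →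
      (∀ k < n, iteratedFDeriv ℂ k h (f^[r] p) = 0) →
      ∃ v : V, ∀ k < n + 1,
        iteratedFDeriv ℂ k (fun z => ι v z - W z * h (f^[r] z)) p = 0) →
      ‖W p‖ * ‖α‖ ^ n ≤ ‖T ^ r‖ := by
    intro n hn hIn
    have hhd : Differentiable ℂ fun z => l (z - p) ^ n := by fun_prop
    obtain ⟨v, hv⟩ := hIn (fun z => l (z - p) ^ n) hhd
      fun k hk => by rw [hp]; exact iteratedFDeriv_clm_sub_pow_eq_zero l p hk
    have hdiff : Differentiable ℂ fun z => ι v z - W z * l (f^[r] z - p) ^ n :=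
      (hent v).sub (hWdiff.mul (hhd.comp (hfit r)))
    have hv' := (hdiff.contDiff_of_finiteDimensional n).isLittleO_of_iteratedFDeriv_eq_zero hv
    have hlead : ∀ k : ℕ, (fun z => ι (((T ^ r) ^ k) v) z - (W p * α ^ n) ^ (k + 1) *
        l (z - p) ^ n) =o[𝓝 p] fun z => ‖z - p‖ ^ n := by
      intro k
      induction k with
      | zero =>
        have h1 := weightedComp_leading_term (hfit r p) hp hWdiff.continuous.continuousAt l hl hn
          (g := fun z => l (z - p) ^ n) (c := 1) (by simp)
        exact (hv'.add h1).congr_left fun z => by simp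
      | succ k ih =>
        have h1 := weightedComp_leading_term (hfit r p) hp hWdiff.continuous.continuousAt l hl hn ih
        refine h1.congr_left fun z => ?_
        rw [pow_succ' (T ^ r) k, mul_apply_eq_comp, weightedComp_pow_apply ι hT r]
        ring
    refine le_of_forall_pow_succ_le_mul_pow (M := C * ‖v‖) (norm_nonneg _) fun k => ?_
    have h1 := norm_leading_coeff_le (hent _) hw (hlead k) (hC _)
    rw [norm_pow, norm_mul, norm_pow] at h1
    have h2 : ‖((T ^ r) ^ k) v‖ ≤ ‖T ^ r‖ ^ k * ‖v‖ := by
      exact ((T ^ r) ^ k).le_of_opNorm_le (hpow k) v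
    calc _ ≤ _ := h1
      _ ≤ C * (‖T ^ r‖ ^ k * ‖v‖) := by gcongr
      _ = _ := by ring
  by_contra! hα1
  have hWp : 0 < ‖W p‖ := norm_pos_iff.2 hur
  have hev := (tendsto_pow_atTop_atTop_of_one_lt hα1).eventually_gt_atTop (‖T ^ r‖ / ‖W p‖)
  obtain ⟨n, ⟨hn, hIn⟩, hlt⟩ := ((Nat.frequently_atTop_iff_infinite.2 hI).and_eventually hev).exists
  have := hbound n hn hIn
  rw [div_lt_iff₀ hWp] at hlt
  linarith
end

section
/- Let V be a complex Banach space with an injective linear map ι into the entire functions on ℂ^d satisfying the continuous-inclusion bounds. Let f : ℂ^d → ℂ^d be holomorphic, u : ℂ^d → ℂ entire, and suppose there is a COMPACT continuous linear operator T : V → V with ι(T h) = u · (ι(h) ∘ f) for all h ∈ V. Let p ∈ ℂ^d be a periodic point of f of period r ≥ 1 (i.e. f^{∘r}(p) = p) with u_r(p) ≠ 0, and suppose Assumption (I) holds for (V, f^{∘r}, u_r, p). Then every eigenvalue α of the Fréchet derivative D(f^{∘r})(p) (a ℂ-linear endomorphism of ℂ^d) satisfies |α| < 1. -/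
open Filter Topology Metric Asymptotics
open scoped ContDiff

section Smoothness

variable {E : Type*} [NormedAddCommGroup E] [NormedSpace ℂ E]

/-- Cauchy's formula for a directional derivative. -/
theorem Differentiable.fderiv_apply_eq_circleIntegral {g : E → ℂ} (hg : Differentiable ℂ g)
    (x v : E) :
    fderiv ℂ g x v =
      (2 * Real.pi * Complex.I)⁻¹ • ∮ z in C(0, 1), (z ^ 2)⁻¹ • g (x + z • v) := by
  have hd : Differentiable ℂ fun z : ℂ => g (x + z • v) := by fun_prop
  have h := Complex.two_pi_I_inv_smul_circleIntegral_sub_sq_inv_smul_of_differentiable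
    (c := (0 : ℂ)) (w₀ := 0) (R := 1) isOpen_univ (Set.subset_univ _) hd.differentiableOn
    (by simp)
  rw [DifferentiableAt.deriv_comp_add_smul (hg _)] at h
  simpa using h.symm

theorem hasFDerivAt_intervalIntegral_of_continuous [FiniteDimensional ℂ E]
    {G : E → ℝ → ℂ} {G' : E → ℝ → E →L[ℂ] ℂ} {a b : ℝ}
    (hG : Continuous (Function.uncurry G)) (hG' : Continuous (Function.uncurry G'))
    (hd : ∀ x θ, HasFDerivAt (fun y => G y θ) (G' x θ) x) (x : E) :
    HasFDerivAt (fun y => ∫ θ in a..b, G y θ) (∫ θ in a..b, G' x θ) x := by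
  have : ProperSpace E := FiniteDimensional.proper ℂ E
  obtain ⟨C, hC⟩ := ((isCompact_closedBall x 1).prod
    (isCompact_uIcc (a := a) (b := b))).exists_bound_of_continuousOn hG'.continuousOn
  have hGx : ∀ y, Continuous (G y) := fun y => hG.comp (Continuous.prodMk_right y)
  have hGx' : ∀ y, Continuous (G' y) := fun y => hG'.comp (Continuous.prodMk_right y)
  refine intervalIntegral.hasFDerivAt_integral_of_dominated_of_fderiv_le
    (bound := fun _ => C) (F' := G') (closedBall_mem_nhds x one_pos)
    (Eventually.of_forall fun y => (hGx y).aestronglyMeasurable)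
    ((hGx x).intervalIntegrable _ _) (hGx' x).aestronglyMeasurable
    (Eventually.of_forall fun θ hθ y hy => hC (y, θ) ⟨hy, Set.uIoc_subset_uIcc hθ⟩)
    intervalIntegrable_const
    (Eventually.of_forall fun θ _ y _ => hd y θ)

/-- A complex differentiable function on a finite-dimensional space is continuously
differentiable. -/
theorem Differentiable.continuous_fderiv_of_finiteDimensional [FiniteDimensional ℂ E]
    {g : E → ℂ} (hg : Differentiable ℂ g) : Continuous (fderiv ℂ g) := by
  rw [continuous_clm_apply]
  intro v
  simp_rw [hg.fderiv_apply_eq_circleIntegral _ v, circleIntegral]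
  have := hg.continuous
  refine Continuous.const_smul (M := ℂ) (α := ℂ)
    (intervalIntegral.continuous_parametric_intervalIntegral_of_continuous ?_ continuous_const) _
  simp only [deriv_circleMap, Function.uncurry_def]
  have hne : ∀ θ : ℝ, circleMap 0 1 θ ^ 2 ≠ 0 := fun θ =>
    pow_ne_zero _ (circleMap_ne_center one_ne_zero)
  have hc : Continuous (circleMap 0 1) := continuous_circleMap 0 1
  have hi : Continuous fun x : E × ℝ => (circleMap 0 1 x.2 ^ 2)⁻¹ :=
    Continuous.inv₀ (by fun_prop) fun x => hne x.2
  fun_prop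

theorem Differentiable.differentiable_fderiv_apply [FiniteDimensional ℂ E]
    {g : E → ℂ} (hg : Differentiable ℂ g) (v : E) :
    Differentiable ℂ fun x => fderiv ℂ g x v := by
  have hg' := hg.continuous_fderiv_of_finiteDimensional
  have hgc := hg.continuous
  simp_rw [hg.fderiv_apply_eq_circleIntegral _ v, circleIntegral]
  refine Differentiable.const_smul (R := ℂ) (F := ℂ) ?_ _
  have hne : ∀ θ : ℝ, circleMap 0 1 θ ^ 2 ≠ 0 := fun θ =>
    pow_ne_zero _ (circleMap_ne_center one_ne_zero)
  have hc : Continuous (circleMap 0 1) := continuous_circleMap 0 1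
  have hi : Continuous fun x : E × ℝ => (circleMap 0 1 x.2 ^ 2)⁻¹ :=
    Continuous.inv₀ (by fun_prop) fun x => hne x.2
  intro x
  refine (hasFDerivAt_intervalIntegral_of_continuous (G' := fun y θ =>
    _root_.deriv (circleMap 0 1) θ • (circleMap 0 1 θ ^ 2)⁻¹ • fderiv ℂ g (y + circleMap 0 1 θ • v))
    ?_ ?_ ?_ x).differentiableAt
  · simp only [deriv_circleMap, Function.uncurry_def]
    fun_prop
  · simp only [deriv_circleMap, Function.uncurry_def]
    fun_prop
  · intro y θ
    have hshift : HasFDerivAt (fun z => g (z + circleMap 0 1 θ • v))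
        (fderiv ℂ g (y + circleMap 0 1 θ • v)) y :=
      (hasFDerivAt_comp_add_right _).2 (hg _).hasFDerivAt
    exact (hshift.const_smul (R := ℂ) (circleMap 0 1 θ ^ 2)⁻¹).const_smul (R := ℂ)
      (_root_.deriv (circleMap 0 1) θ)

/-- A scalar complex differentiable function on a finite-dimensional space is smooth. -/
theorem Differentiable.contDiff_of_finiteDimensional_s1 [FiniteDimensional ℂ E]
    {g : E → ℂ} (hg : Differentiable ℂ g) : ContDiff ℂ ∞ g := by
  rw [contDiff_infty]
  intro n
  induction n generalizing g with
  | zero => exact contDiff_zero.2 hg.continuous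
  | succ n ih =>
    push_cast
    rw [contDiff_succ_iff_fderiv_apply]
    exact ⟨hg, by simp, fun v => ih (hg.differentiable_fderiv_apply v)⟩

end Smoothness

section Taylor

theorem iteratedDeriv_comp_add_smul {𝕜 E F : Type*} [NontriviallyNormedField 𝕜]
    [NormedAddCommGroup E] [NormedSpace 𝕜 E] [NormedAddCommGroup F] [NormedSpace 𝕜 F]
    {g : E → F} (hg : ContDiff 𝕜 ∞ g) (p y : E) (k : ℕ) :
    iteratedDeriv k (fun t : 𝕜 => g (p + t • y)) =
      fun t => iteratedFDeriv 𝕜 k g (p + t • y) fun _ => y := by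
  induction k with
  | zero => ext t; simp
  | succ k ih =>
    ext t
    rw [iteratedDeriv_succ, ih]
    exact ContDiffAt.deriv_fderiv_add_smul (hg.contDiffAt.of_le (by exact_mod_cast le_top))

theorem norm_sub_taylor_le_of_iteratedDeriv_eq_zero {G : ℂ → ℂ} (hG : Differentiable ℂ G)
    {n : ℕ} (h0 : ∀ k < n, iteratedDeriv k G 0 = 0) {M : ℝ}
    (hM : ∀ z ∈ sphere (0 : ℂ) 2, ‖G z‖ ≤ M) {t : ℂ} (ht : ‖t‖ ≤ 1) :
    ‖G t - t ^ n * (iteratedDeriv n G 0 / n.factorial)‖ ≤ M * ‖t‖ ^ (n + 1) := by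
  have hs := Complex.hasSum_taylorSeries_of_entire hG 0 t
  have hs' := (hasSum_nat_add_iff' (n + 1)).2 hs
  rw [Finset.sum_range_succ, Finset.sum_eq_zero (fun k hk => by
    rw [h0 k (Finset.mem_range.1 hk)]; simp), zero_add] at hs'
  have hM0 : 0 ≤ M := (norm_nonneg _).trans (hM 2 (by simp))
  have hgeom : HasSum (fun k : ℕ => M * ‖t‖ ^ (n + 1) * (1 / 2 / 2 ^ k)) (M * ‖t‖ ^ (n + 1)) := by
    simpa using (hasSum_geometric_two' 1).mul_left (M * ‖t‖ ^ (n + 1))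
  have heq : t ^ n * (iteratedDeriv n G 0 / n.factorial) =
      (n.factorial : ℂ)⁻¹ • (t - 0) ^ n • iteratedDeriv n G 0 := by
    simp only [sub_zero, smul_eq_mul]
    ring
  rw [heq]
  refine hs'.norm_le_of_bounded hgeom fun k => ?_
  have hc := Complex.norm_iteratedDeriv_le_of_forall_mem_sphere_norm_le (k + (n + 1))
    two_pos hG.diffContOnCl hM
  have hf : (0 : ℝ) < (k + (n + 1)).factorial := by positivity
  simp only [sub_zero, norm_smul, norm_inv, norm_pow, Complex.norm_natCast]
  have ht' : ‖t‖ ^ k ≤ 1 := pow_le_one₀ (norm_nonneg _) ht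
  have h2 : (1 : ℝ) ≤ 2 ^ n := one_le_pow₀ one_le_two
  calc ((k + (n + 1)).factorial : ℝ)⁻¹ *
        (‖t‖ ^ (k + (n + 1)) * ‖iteratedDeriv (k + (n + 1)) G 0‖)
      ≤ ((k + (n + 1)).factorial : ℝ)⁻¹ * (‖t‖ ^ (k + (n + 1)) *
        ((k + (n + 1)).factorial * M / 2 ^ (k + (n + 1)))) := by gcongr
    _ = M * ‖t‖ ^ (n + 1) * (1 / 2 / 2 ^ k) * (‖t‖ ^ k / 2 ^ n) := by
        field_simp
        ring
    _ ≤ M * ‖t‖ ^ (n + 1) * (1 / 2 / 2 ^ k) :=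
        mul_le_of_le_one_right (by positivity)
          ((div_le_one (by positivity)).2 (ht'.trans h2))

variable {E : Type*} [NormedAddCommGroup E] [NormedSpace ℂ E] [FiniteDimensional ℂ E]

theorem exists_norm_sub_taylor_le {g : E → ℂ} (hg : Differentiable ℂ g) {p : E} {n : ℕ}
    (h0 : ∀ k < n, ∀ y : E, iteratedFDeriv ℂ k g p (fun _ => y) = 0) (R : ℝ) :
    ∃ M, ∀ y : E, ‖y‖ ≤ R → ∀ t : ℂ, ‖t‖ ≤ 1 →
      ‖g (p + t • y) - t ^ n * (iteratedFDeriv ℂ n g p (fun _ => y) / n.factorial)‖ ≤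
        M * ‖t‖ ^ (n + 1) := by
  have : ProperSpace E := FiniteDimensional.proper ℂ E
  have hsm := hg.contDiff_of_finiteDimensional_s1
  obtain ⟨M, hM⟩ := (isCompact_closedBall p (2 * R)).exists_bound_of_continuousOn
    hg.continuous.continuousOn
  have hline : ∀ (y : E) k, iteratedDeriv k (fun t : ℂ => g (p + t • y)) 0 =
      iteratedFDeriv ℂ k g p fun _ => y := fun y k => by
    simp [iteratedDeriv_comp_add_smul hsm]
  refine ⟨M, fun y hy t ht => ?_⟩
  rw [← hline]
  refine norm_sub_taylor_le_of_iteratedDeriv_eq_zero (G := fun t : ℂ => g (p + t • y))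
    (by fun_prop) (fun k hk => by rw [hline, h0 k hk]) (fun z hz => hM _ ?_) ht
  have hz' : ‖z‖ = 2 := by simpa using hz
  simp only [mem_closedBall, dist_self_add_left, norm_smul, hz']
  gcongr

/-- The leading Taylor coefficient as a limit along a curve with prescribed direction. -/
theorem tendsto_div_pow_of_iteratedFDeriv_eq_zero {g : E → ℂ} (hg : Differentiable ℂ g)
    {p : E} {n : ℕ} (h0 : ∀ k < n, ∀ y : E, iteratedFDeriv ℂ k g p (fun _ => y) = 0)
    {q : ℂ → E} {y : E} (hq : Tendsto (fun t : ℂ => t⁻¹ • (q t - p)) (𝓝[≠] 0) (𝓝 y)) :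
    Tendsto (fun t : ℂ => g (q t) / t ^ n) (𝓝[≠] 0)
      (𝓝 (iteratedFDeriv ℂ n g p (fun _ => y) / n.factorial)) := by
  obtain ⟨M, hM⟩ := exists_norm_sub_taylor_le hg h0 (‖y‖ + 1)
  have hcont : Continuous fun y : E => iteratedFDeriv ℂ n g p (fun _ => y) / n.factorial := by
    have := (iteratedFDeriv ℂ n g p).cont
    fun_prop
  have hmain := (hcont.tendsto y).comp hq
  have herr : Tendsto (fun t : ℂ => g (q t) / t ^ n -
      iteratedFDeriv ℂ n g p (fun _ => t⁻¹ • (q t - p)) / n.factorial) (𝓝[≠] 0) (𝓝 0) := by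
    have hsmall : Tendsto (fun t : ℂ => M * ‖t‖) (𝓝[≠] 0) (𝓝 0) := by
      have : Tendsto (fun t : ℂ => M * ‖t‖) (𝓝 0) (𝓝 (M * ‖(0 : ℂ)‖)) := by
        apply Continuous.tendsto
        fun_prop
      rw [norm_zero, mul_zero] at this
      exact this.mono_left nhdsWithin_le_nhds
    refine squeeze_zero_norm' ?_ hsmall
    have hball : ∀ᶠ t : ℂ in 𝓝[≠] 0, ‖t‖ ≤ 1 := by
      filter_upwards [nhdsWithin_le_nhds (closedBall_mem_nhds (0 : ℂ) one_pos)] with t ht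
      simpa using ht
    filter_upwards [self_mem_nhdsWithin, hball,
      hq.norm.eventually (eventually_le_nhds (lt_add_one ‖y‖))] with t ht ht1 hyt
    have ht0 : t ≠ 0 := ht
    have h := hM _ hyt t ht1
    rw [smul_inv_smul₀ ht0, add_sub_cancel] at h
    rw [div_sub' (pow_ne_zero n ht0), norm_div, norm_pow,
      div_le_iff₀ (pow_pos (norm_pos_iff.2 ht0) n)]
    calc _ ≤ _ := h
      _ = _ := by ring
  simpa using herr.add hmain

theorem isBigO_pow_of_iteratedFDeriv_eq_zero {g : E → ℂ} (hg : Differentiable ℂ g)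
    {p : E} {n : ℕ} (h0 : ∀ k < n, ∀ y : E, iteratedFDeriv ℂ k g p (fun _ => y) = 0) :
    g =O[𝓝 p] fun z => ‖z - p‖ ^ n := by
  cases n with
  | zero => simpa using (hg.continuous.tendsto p).isBigO_one ℝ
  | succ n =>
    obtain ⟨M, hM⟩ := exists_norm_sub_taylor_le hg (fun k hk => h0 k (hk.trans n.lt_succ_self)) 1
    refine IsBigO.of_bound M ?_
    filter_upwards [closedBall_mem_nhds p one_pos] with z hz
    have hz' : ‖z - p‖ ≤ 1 := by simpa [dist_eq_norm] using hz
    have hinv : ((‖z - p‖ : ℝ) : ℂ) • (((‖z - p‖ : ℝ) : ℂ)⁻¹ • (z - p)) = z - p := by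
      rcases eq_or_ne (z - p) 0 with h | h
      · simp [h]
      · exact smul_inv_smul₀ (by simpa using h) _
    have h := hM (((‖z - p‖ : ℝ) : ℂ)⁻¹ • (z - p))
      (by simpa [norm_smul] using inv_mul_le_one) (‖z - p‖ : ℝ) (by simpa using hz')
    rw [hinv, add_sub_cancel, h0 n n.lt_succ_self] at h
    simpa using h

theorem iteratedFDeriv_eq_zero_of_isBigO_pow {g : E → ℂ} (hg : Differentiable ℂ g)
    {p : E} {n : ℕ} (h : g =O[𝓝 p] fun z => ‖z - p‖ ^ n) :
    ∀ k < n, ∀ y : E, iteratedFDeriv ℂ k g p (fun _ => y) = 0 := by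
  intro k
  induction k using Nat.strong_induction_on with
  | _ k ih =>
  intro hk y
  have hq : Tendsto (fun t : ℂ => t⁻¹ • ((p + t • y) - p)) (𝓝[≠] 0) (𝓝 y) := by
    refine tendsto_const_nhds.congr' ?_
    filter_upwards [self_mem_nhdsWithin] with t ht
    rw [add_sub_cancel_left, inv_smul_smul₀ ht]
  have hlim := tendsto_div_pow_of_iteratedFDeriv_eq_zero hg
    (fun j hj => ih j hj (hj.trans hk)) hq
  have hline : Tendsto (fun t : ℂ => p + t • y) (𝓝[≠] 0) (𝓝 p) := by
    have : Tendsto (fun t : ℂ => p + t • y) (𝓝 0) (𝓝 (p + (0 : ℂ) • y)) :=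
      Continuous.tendsto (by fun_prop) 0
    rw [zero_smul, add_zero] at this
    exact this.mono_left nhdsWithin_le_nhds
  obtain ⟨C, hC⟩ := (h.comp_tendsto hline).bound
  have hzero : Tendsto (fun t : ℂ => g (p + t • y) / t ^ k) (𝓝[≠] 0) (𝓝 0) := by
    have hsmall : Tendsto (fun t : ℂ => C * ‖y‖ ^ n * ‖t‖ ^ (n - k)) (𝓝[≠] 0) (𝓝 0) := by
      have : Tendsto (fun t : ℂ => C * ‖y‖ ^ n * ‖t‖ ^ (n - k)) (𝓝 0)
          (𝓝 (C * ‖y‖ ^ n * ‖(0 : ℂ)‖ ^ (n - k))) := Continuous.tendsto (by fun_prop) 0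
      rw [norm_zero, zero_pow (Nat.sub_ne_zero_of_lt hk), mul_zero] at this
      exact this.mono_left nhdsWithin_le_nhds
    refine squeeze_zero_norm' ?_ hsmall
    filter_upwards [self_mem_nhdsWithin, hC] with t ht htC
    have ht0 : t ≠ 0 := ht
    rw [norm_div, norm_pow, div_le_iff₀ (pow_pos (norm_pos_iff.2 ht0) k), mul_assoc, ← pow_add,
      Nat.sub_add_cancel hk.le]
    simpa [norm_smul, mul_pow, mul_assoc, mul_comm (‖t‖ ^ n)] using htC
  have := tendsto_nhds_unique hlim hzero
  simpa [Nat.factorial_ne_zero] using this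

end Taylor

section Compactness

/-- A compact operator cannot act on infinitely many steps of a decreasing filtration by
multipliers bounded away from zero. -/
theorem IsCompactOperator.false_of_filtration {V : Type*} [NormedAddCommGroup V]
    [NormedSpace ℂ V] {S : V →L[ℂ] V} (hS : IsCompactOperator S) {N : Set ℕ} (hN : N.Infinite)
    (W : ℕ → Submodule ℂ V) (φ : ℕ → V →L[ℂ] ℂ) (μ : ℕ → ℂ) {δ : ℝ} (hδ : 0 < δ)
    (hμ : ∀ n, δ ≤ ‖μ n‖) (hSW : ∀ n, ∀ x ∈ W n, S x ∈ W n) (hW : Antitone W)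
    (hφS : ∀ n, ∀ x ∈ W n, φ n (S x) = μ n * φ n x)
    (hφW : ∀ n m, n < m → ∀ x ∈ W m, φ n x = 0)
    (hne : ∀ n ∈ N, ∃ x ∈ W n, φ n x ≠ 0) : False := by
  have hsel : ∀ n ∈ N, ∃ x : W n, 0 < ‖(φ n).comp (W n).subtypeL‖ ∧ ‖x‖ < 1 ∧
      ‖(φ n).comp (W n).subtypeL‖ / 2 < ‖φ n x‖ := by
    intro n hn
    obtain ⟨x, hx, hx0⟩ := hne n hn
    have hpos : 0 < ‖(φ n).comp (W n).subtypeL‖ := by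
      refine lt_of_le_of_ne' (ContinuousLinearMap.opNorm_nonneg _) fun h => hx0 ?_
      simpa [h] using ((φ n).comp (W n).subtypeL).le_opNorm ⟨x, hx⟩
    obtain ⟨y, hy1, hy2⟩ :=
      ((φ n).comp (W n).subtypeL).exists_lt_apply_of_lt_opNorm (half_lt_self hpos)
    exact ⟨y, hpos, hy1, hy2⟩
  choose! x hpos hx1 hx2 using hsel
  obtain ⟨e, he, heN⟩ : ∃ e : ℕ → ℕ, StrictMono e ∧ ∀ i, e i ∈ N :=
    ⟨Nat.nth (· ∈ N), Nat.nth_strictMono hN, Nat.nth_mem_of_infinite hN⟩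
  obtain ⟨K, hK, hSK⟩ := IsCompactOperator.image_closedBall_subset_compact
    (f := (S : V →ₗ[ℂ] V)) hS 1
  have hz : ∀ i, S (x (e i)) ∈ K := fun i =>
    hSK ⟨x (e i), by simpa using (hx1 _ (heN i)).le, rfl⟩
  obtain ⟨a, -, s, hs, hlim⟩ := hK.tendsto_subseq hz
  obtain ⟨m, hm⟩ := Metric.cauchySeq_iff'.1 hlim.cauchySeq (δ / 2) (half_pos hδ)
  set i := e (s m) with hi
  set j := e (s (m + 1)) with hj
  have hij : i < j := he (hs m.lt_succ_self)
  have hiN : i ∈ N := heN _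
  have hdist : ‖S (x j) - S (x i)‖ < δ / 2 := by
    simpa [dist_eq_norm] using hm (m + 1) m.le_succ
  have hxj : S (x j) ∈ W j := hSW _ _ (x j).2
  have hmem : S (x j) - S (x i) ∈ W i :=
    Submodule.sub_mem _ (hW hij.le hxj) (hSW _ _ (x i).2)
  have hval : φ i (S (x j) - S (x i)) = -(μ i * φ i (x i)) := by
    rw [map_sub, hφW i j hij _ hxj, hφS _ _ (x i).2, zero_sub]
  have hle := ((φ i).comp (W i).subtypeL).le_opNorm ⟨_, hmem⟩
  simp only [ContinuousLinearMap.comp_apply, Submodule.subtypeL_apply, hval, norm_neg, norm_mul,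
    Submodule.coe_norm] at hle
  have h1 : δ * (‖(φ i).comp (W i).subtypeL‖ / 2) ≤ ‖μ i‖ * ‖φ i (x i)‖ :=
    mul_le_mul (hμ i) (hx2 i hiN).le (half_pos (hpos i hiN)).le (norm_nonneg _)
  have h2 := mul_lt_mul_of_pos_left hdist (hpos i hiN)
  linarith

end Compactness

/-- Leading Taylor coefficient of a weighted composition with a map fixing the base point, in an
eigendirection. -/
theorem tendsto_weighted_comp_div_pow {E : Type*} [NormedAddCommGroup E] [NormedSpace ℂ E]
    [FiniteDimensional ℂ E] {g : E → ℂ} (hg : Differentiable ℂ g) {F : E → E} {U : E → ℂ} {p : E}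
    (hF : DifferentiableAt ℂ F p) (hU : ContinuousAt U p) (hFp : F p = p) {w : E} {α : ℂ}
    (hw : fderiv ℂ F p w = α • w) {n : ℕ}
    (h0 : ∀ k < n, ∀ y : E, iteratedFDeriv ℂ k g p (fun _ => y) = 0) :
    Tendsto (fun t : ℂ => U (p + t • w) * g (F (p + t • w)) / t ^ n) (𝓝[≠] 0)
      (𝓝 (U p * α ^ n * (iteratedFDeriv ℂ n g p (fun _ => w) / n.factorial))) := by
  have hq : Tendsto (fun t : ℂ => t⁻¹ • (F (p + t • w) - p)) (𝓝[≠] 0) (𝓝 (α • w)) := by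
    have hd : HasDerivAt (fun t : ℂ => F (p + t • w)) (α • w) 0 := by
      have hl : HasDerivAt (fun t : ℂ => p + t • w) w 0 := by
        simpa using ((hasDerivAt_id (0 : ℂ)).smul_const w).const_add p
      have hF' : HasFDerivAt F (fderiv ℂ F p) (p + (0 : ℂ) • w) := by simpa using hF.hasFDerivAt
      simpa [hw, Function.comp_def] using hF'.comp_hasDerivAt 0 hl
    simpa [hFp] using hd.tendsto_slope_zero
  have hUl : Tendsto (fun t : ℂ => U (p + t • w)) (𝓝[≠] 0) (𝓝 (U p)) := by
    have hl : Tendsto (fun t : ℂ => p + t • w) (𝓝 0) (𝓝 (p + (0 : ℂ) • w)) :=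
      Continuous.tendsto (by fun_prop) 0
    rw [zero_smul, add_zero] at hl
    exact (hU.tendsto.comp hl).mono_left nhdsWithin_le_nhds
  have h := hUl.mul (tendsto_div_pow_of_iteratedFDeriv_eq_zero hg h0 hq)
  simp only [← mul_div_assoc] at h
  convert h using 2
  rw [ContinuousMultilinearMap.map_smul_univ (iteratedFDeriv ℂ n g p) (fun _ => α) fun _ => w]
  simp [mul_assoc, mul_div_assoc]

theorem isBigO_weighted_comp {E : Type*} [NormedAddCommGroup E] [NormedSpace ℂ E]
    {g : E → ℂ} {F : E → E} {U : E → ℂ} {p : E} (hF : DifferentiableAt ℂ F p)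
    (hU : ContinuousAt U p) (hFp : F p = p) {n : ℕ} (hg : g =O[𝓝 p] fun z => ‖z - p‖ ^ n) :
    (fun z => U z * g (F z)) =O[𝓝 p] fun z => ‖z - p‖ ^ n := by
  have hFt : Tendsto F (𝓝 p) (𝓝 p) := by simpa [hFp] using hF.continuousAt.tendsto
  have h1 := hg.comp_tendsto hFt
  have h2 : (fun z => F z - p) =O[𝓝 p] fun z => z - p := by
    simpa [hFp] using hF.hasFDerivAt.isBigO_sub
  have h3 := hU.tendsto.isBigO_one ℝ |>.mul (h1.trans (h2.norm_norm.pow n))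
  simpa using h3

theorem iteratedFDeriv_sub_pow_eq_zero {d : ℕ} (i : Fin d) (p : Fin d → ℂ) {k n : ℕ}
    (hk : k < n) : iteratedFDeriv ℂ k (fun z : Fin d → ℂ => (z i - p i) ^ n) p = 0 := by
  have h := ContinuousLinearMap.iteratedFDeriv_comp_right (n := ∞)
    (ContinuousLinearMap.proj (R := ℂ) (φ := fun _ : Fin d => ℂ) i)
    (f := fun s : ℂ => (s - p i) ^ n) (by fun_prop) p (i := k) (by exact_mod_cast le_top)
  have hz : iteratedFDeriv ℂ k (fun s : ℂ => (s - p i) ^ n) (p i) = 0 := by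
    rw [← norm_eq_zero, norm_iteratedFDeriv_eq_norm_iteratedDeriv,
      iteratedDeriv_comp_sub_const k (fun s : ℂ => s ^ n)]
    simp only [sub_self, iteratedDeriv_fun_pow_zero, hk.ne, if_false, Nat.cast_zero, norm_zero]
  rw [ContinuousLinearMap.proj_apply, hz] at h
  rw [show (fun z : Fin d → ℂ => (z i - p i) ^ n) = (fun s : ℂ => (s - p i) ^ n) ∘
    (ContinuousLinearMap.proj (R := ℂ) (φ := fun _ : Fin d => ℂ) i) from rfl, h]
  ext
  simp

section Space

variable {E V : Type*} [NormedAddCommGroup E] [NormedSpace ℂ E] [FiniteDimensional ℂ E]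
  [NormedAddCommGroup V] [NormedSpace ℂ V]

theorem iteratedFDeriv_linearMap_add (ι : V →ₗ[ℂ] (E → ℂ)) (hent : ∀ h, Differentiable ℂ (ι h))
    (p : E) (n : ℕ) (x y : V) :
    iteratedFDeriv ℂ n (ι (x + y)) p =
      iteratedFDeriv ℂ n (ι x) p + iteratedFDeriv ℂ n (ι y) p := by
  have hs : ∀ h : V, ContDiffAt ℂ n (ι h) p := fun h =>
    (hent h).contDiff_of_finiteDimensional_s1.contDiffAt.of_le (by exact_mod_cast le_top)
  rw [map_add, iteratedFDeriv_add_apply (hs x) (hs y)]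

theorem iteratedFDeriv_linearMap_smul (ι : V →ₗ[ℂ] (E → ℂ))
    (hent : ∀ h, Differentiable ℂ (ι h)) (p : E) (n : ℕ) (c : ℂ) (x : V) :
    iteratedFDeriv ℂ n (ι (c • x)) p = c • iteratedFDeriv ℂ n (ι x) p := by
  rw [map_smul, iteratedFDeriv_const_smul_apply
    ((hent x).contDiff_of_finiteDimensional_s1.contDiffAt.of_le (by exact_mod_cast le_top))]

theorem exists_taylorCoeff_continuousLinearMap (ι : V →ₗ[ℂ] (E → ℂ))
    (hent : ∀ h, Differentiable ℂ (ι h))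
    (hbd : ∀ K : Set E, IsCompact K → ∃ C : ℝ, 0 ≤ C ∧ ∀ h : V, ∀ z ∈ K, ‖ι h z‖ ≤ C * ‖h‖)
    (p w : E) (n : ℕ) :
    ∃ φ : V →L[ℂ] ℂ, ∀ h, φ h = iteratedFDeriv ℂ n (ι h) p fun _ => w := by
  obtain ⟨C, -, hC⟩ := hbd ((fun t : ℂ => p + t • w) '' sphere 0 1)
    ((isCompact_sphere 0 1).image (by fun_prop))
  let φ : V →ₗ[ℂ] ℂ :=
    { toFun := fun h => iteratedFDeriv ℂ n (ι h) p fun _ => w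
      map_add' := fun x y => by rw [iteratedFDeriv_linearMap_add ι hent]; rfl
      map_smul' := fun c x => by rw [iteratedFDeriv_linearMap_smul ι hent]; rfl }
  refine ⟨φ.mkContinuous (n.factorial * C) fun h => ?_, fun h => rfl⟩
  have hd : Differentiable ℂ fun t : ℂ => ι h (p + t • w) := by
    have := hent h
    fun_prop
  have := Complex.norm_iteratedDeriv_le_of_forall_mem_sphere_norm_le n one_pos
    hd.diffContOnCl (C := C * ‖h‖) fun z hz => hC h _ ⟨z, hz, rfl⟩
  rw [iteratedDeriv_comp_add_smul (hent h).contDiff_of_finiteDimensional_s1] at this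
  simpa [φ, mul_assoc] using this

/-- The subspace of elements of `V` whose associated function vanishes to order `n` at `p`. -/
def vanishingSubmodule (ι : V →ₗ[ℂ] (E → ℂ)) (hent : ∀ h, Differentiable ℂ (ι h)) (p : E)
    (n : ℕ) : Submodule ℂ V where
  carrier := {h | ∀ k < n, ∀ y : E, iteratedFDeriv ℂ k (ι h) p (fun _ => y) = 0}
  zero_mem' := fun k _ y => by
    have h := iteratedFDeriv_linearMap_smul ι hent p k 0 0
    rw [zero_smul, zero_smul] at h
    rw [h]; rfl
  add_mem' := fun {x y} hx hy k hk z => by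
    rw [iteratedFDeriv_linearMap_add ι hent, add_apply, hx k hk, hy k hk,
      add_zero]
  smul_mem' := fun c x hx k hk z => by
    rw [iteratedFDeriv_linearMap_smul ι hent, smul_apply, hx k hk, smul_zero]

end Space

theorem iterate_weighted_comp {X V : Type*} [NormedAddCommGroup V] [NormedSpace ℂ V]
    (ι : V →ₗ[ℂ] (X → ℂ)) (f : X → X) (u : X → ℂ) (T : V →L[ℂ] V)
    (hT : ∀ h : V, ι (T h) = fun z => u z * ι h (f z)) (r : ℕ) (h : V) :
    ι ((T ^ r) h) = fun z => (∏ j ∈ Finset.range r, u (f^[j] z)) * ι h (f^[r] z) := by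
  induction r generalizing h with
  | zero => simp
  | succ r ih =>
    ext z
    rw [pow_succ, mul_apply_eq_comp, ih, hT, Finset.prod_range_succ,
      Function.iterate_succ_apply']
    ring

/-- compactness of a weighted composition operator on a Banach space of
entire functions on ℂ^d forces every eigenvalue of `D(f^[r]) p` at a periodic point `p`
(with `u_r p ≠ 0` and Assumption (I)) to have modulus strictly less than 1 (compact case). -/
theorem compact_weighted_composition_eigenvalue_lt_one
    {d : ℕ} {V : Type*} [NormedAddCommGroup V] [NormedSpace ℂ V] [CompleteSpace V]
    (ι : V →ₗ[ℂ] ((Fin d → ℂ) → ℂ)) (hinj : Function.Injective ι)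
    (hent : ∀ h : V, Differentiable ℂ (ι h))
    (hbd : ∀ K : Set (Fin d → ℂ), IsCompact K →
      ∃ C : ℝ, 0 ≤ C ∧ ∀ h : V, ∀ z ∈ K, ‖ι h z‖ ≤ C * ‖h‖)
    (f : (Fin d → ℂ) → (Fin d → ℂ)) (hf : Differentiable ℂ f)
    (u : (Fin d → ℂ) → ℂ) (hu : Differentiable ℂ u)
    (T : V →L[ℂ] V) (hTc : IsCompactOperator (⇑T)) (hT : ∀ h : V, ι (T h) = fun z => u z * ι h (f z))
    (p : Fin d → ℂ) (r : ℕ) (hr : 1 ≤ r) (hp : f^[r] p = p)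
    (hur : (∏ j ∈ Finset.range r, u (f^[j] p)) ≠ 0)
    (hI : {n : ℕ | 1 ≤ n ∧ ∀ h : (Fin d → ℂ) → ℂ, Differentiable ℂ h →
        (∀ k < n, iteratedFDeriv ℂ k h (f^[r] p) = 0) →
        ∃ v : V, ∀ k < n + 1,
          iteratedFDeriv ℂ k
            (fun z => ι v z - (∏ j ∈ Finset.range r, u (f^[j] z)) * h (f^[r] z)) p = 0}.Infinite)
    (α : ℂ) (hα : ∃ v : Fin d → ℂ, v ≠ 0 ∧ fderiv ℂ (f^[r]) p v = α • v) :
    ‖α‖ < 1 := by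
  obtain ⟨w, hw0, hw⟩ := hα
  by_contra! hα1
  have hα0 : α ≠ 0 := fun h => by norm_num [h] at hα1
  set F := f^[r] with hFdef
  set U : (Fin d → ℂ) → ℂ := fun z => ∏ j ∈ Finset.range r, u (f^[j] z) with hUdef
  have hF : Differentiable ℂ F := hf.iterate r
  have hU : Differentiable ℂ U :=
    fun z => (HasFDerivAt.finsetProd fun j _ =>
      ((hu.comp (hf.iterate j)) z).hasFDerivAt).differentiableAt
  have hS := iterate_weighted_comp ι f u T hT r
  have hSc : IsCompactOperator (T ^ r : V →L[ℂ] V) := by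
    obtain ⟨k, rfl⟩ : ∃ k, r = k + 1 := ⟨r - 1, by omega⟩
    rw [pow_succ]
    exact hTc.clm_comp (T ^ k)
  choose φ hφ using exists_taylorCoeff_continuousLinearMap ι hent hbd p w
  have hlimit : ∀ {n : ℕ} {g : (Fin d → ℂ) → ℂ}, Differentiable ℂ g →
      (∀ k < n, ∀ y, iteratedFDeriv ℂ k g p (fun _ => y) = 0) →
      Tendsto (fun t : ℂ => g (p + t • w) / t ^ n) (𝓝[≠] 0)
        (𝓝 (iteratedFDeriv ℂ n g p (fun _ => w) / n.factorial)) := fun hg h0 => by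
    simpa using tendsto_weighted_comp_div_pow hg (F := id) (U := fun _ => 1) (α := 1) (w := w)
      differentiableAt_id continuousAt_const rfl (by simp) h0
  have hSW : ∀ n, ∀ x ∈ vanishingSubmodule ι hent p n,
      (T ^ r) x ∈ vanishingSubmodule ι hent p n := fun n x hx => by
    refine iteratedFDeriv_eq_zero_of_isBigO_pow (hent _) ?_
    rw [hS]
    exact isBigO_weighted_comp (hF p) (hU p).continuousAt hp
      (isBigO_pow_of_iteratedFDeriv_eq_zero (hent x) hx)
  refine hSc.false_of_filtration hI (vanishingSubmodule ι hent p) φ (fun n => U p * α ^ n)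
    (norm_pos_iff.2 hur) (fun n => ?_) hSW (fun m n hmn x hx k hk => hx k (hk.trans_le hmn))
    (fun n x hx => ?_) (fun n m hnm x hx => (hφ n x).trans (hx n hnm w)) ?_
  · rw [norm_mul, norm_pow]
    exact le_mul_of_one_le_right (norm_nonneg _) (one_le_pow₀ hα1)
  · have h1 := hlimit (hent _) (hSW n x hx)
    have h2 := tendsto_weighted_comp_div_pow (hent x) (hF p) (hU p).continuousAt hp hw hx
    rw [hS] at h1
    have h := tendsto_nhds_unique h1 h2
    rw [← hS, ← hφ, ← hφ, ← mul_div_assoc] at h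
    exact (div_left_inj' (by exact_mod_cast n.factorial_ne_zero)).1 h
  · rintro n ⟨-, hn⟩
    obtain ⟨i, hi⟩ := Function.ne_iff.1 hw0
    set q : (Fin d → ℂ) → ℂ := fun z => (z i - p i) ^ n with hq
    have hqd : Differentiable ℂ q := by fun_prop
    obtain ⟨v, hv⟩ := hn q hqd fun k hk => by
      rw [hp]; exact iteratedFDeriv_sub_pow_eq_zero i p hk
    set G : (Fin d → ℂ) → ℂ := fun z => ι v z - U z * q (F z) with hG
    have hGd : Differentiable ℂ G := (hent v).sub (hU.mul (hqd.comp hF))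
    have hG0 : ∀ k < n + 1, ∀ y, iteratedFDeriv ℂ k G p (fun _ => y) = 0 := fun k hk y => by
      have := hv k hk
      rw [show iteratedFDeriv ℂ k G p = 0 from this]
      rfl
    have hq0 : ∀ k < n, ∀ y, iteratedFDeriv ℂ k q p (fun _ => y) = 0 := fun k hk y => by
      rw [iteratedFDeriv_sub_pow_eq_zero i p hk]; rfl
    have hιv : ι v = fun z => G z + U z * q (F z) := by ext z; simp [hG]
    have hvmem : v ∈ vanishingSubmodule ι hent p n := by
      refine iteratedFDeriv_eq_zero_of_isBigO_pow (hent _) ?_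
      rw [hιv]
      exact (isBigO_pow_of_iteratedFDeriv_eq_zero hGd
        fun k hk => hG0 k (hk.trans n.lt_succ_self)).add
        (isBigO_weighted_comp (hF p) (hU p).continuousAt hp
          (isBigO_pow_of_iteratedFDeriv_eq_zero hqd hq0))
    refine ⟨v, hvmem, fun hzero => ?_⟩
    have h1 := hlimit (hent v) hvmem
    have h2 := (hlimit hGd fun k hk => hG0 k (hk.trans n.lt_succ_self)).add
      (tendsto_weighted_comp_div_pow hqd (hF p) (hU p).continuousAt hp hw hq0)
    simp only [← add_div] at h2
    rw [hιv] at h1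
    have h := tendsto_nhds_unique h1 h2
    rw [← hιv, ← hφ, hzero, hG0 n n.lt_succ_self, zero_div, zero_add] at h
    have hqw : iteratedFDeriv ℂ n q p (fun _ => w) / n.factorial = w i ^ n := by
      refine tendsto_nhds_unique (hlimit hqd hq0) (tendsto_const_nhds.congr' ?_)
      filter_upwards [self_mem_nhdsWithin] with t ht
      have ht0 : t ≠ 0 := ht
      simp [hq, mul_pow, ht0]
    rw [hqw] at h
    exact mul_ne_zero (mul_ne_zero hur (pow_ne_zero n hα0)) (pow_ne_zero n hi) h.symm
end

section
/- Let U ⊆ ℂ be a nonempty connected open set. Let V be an infinite-dimensional complex Banach space with an injective linear map ι : V → (U → ℂ) such that ι(h) is holomorphic on U for every h ∈ V and for every compact K ⊆ U there is C ≥ 0 with sup_{z ∈ K} |ι(h)(z)| ≤ C·‖h‖ for all h ∈ V. Let f : U → U be holomorphic and u : U → ℂ holomorphic and not identically zero. Suppose there exists a continuous linear operator T : V → V with ι(T h) = u · (ι(h) ∘ f) for all h ∈ V. Then for every fixed point p ∈ U of f (f(p) = p), the derivative satisfies |f'(p)| ≤ 1. -/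
open Filter Topology Set

/-- If `F z / (z - p) ^ n` tends to a limit at `p`, this limit obeys Cauchy's estimate for the
`n`-th Taylor coefficient. -/
theorem norm_leadingCoeff_mul_pow_le {U : Set ℂ} (hU : IsOpen U) {F : ℂ → ℂ}
    (hF : DifferentiableOn ℂ F U) {p : ℂ} {r : ℝ} (hr : 0 < r)
    (hrU : Metric.closedBall p r ⊆ U) {n : ℕ} {c : ℂ}
    (hc : Tendsto (fun z ↦ F z / (z - p) ^ n) (𝓝[≠] p) (𝓝 c)) {M : ℝ}
    (hM : ∀ z ∈ Metric.closedBall p r, ‖F z‖ ≤ M) :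
    ‖c‖ * r ^ n ≤ M := by
  classical
  set G : ℂ → ℂ := Function.update (fun z ↦ F z / (z - p) ^ n) p c with hG
  have hpU : U ∈ 𝓝 p := hU.mem_nhds (hrU (Metric.mem_closedBall_self hr.le))
  have hGd : DifferentiableOn ℂ G U := by
    refine (Complex.differentiableOn_compl_singleton_and_continuousAt_iff hpU).1
      ⟨?_, continuousAt_update_same.2 hc⟩
    have : DifferentiableOn ℂ (fun z ↦ F z / (z - p) ^ n) (U \ {p}) := by
      refine (hF.mono sdiff_subset).div (by fun_prop) fun z hz ↦ ?_
      exact pow_ne_zero _ (sub_ne_zero.2 hz.2)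
    exact this.congr fun z hz ↦ Function.update_of_ne hz.2 _ _
  have hmax := Complex.norm_le_of_forall_mem_frontier_norm_le (U := Metric.ball p r)
    Metric.isBounded_ball (hGd.diffContOnCl_ball hrU) (C := M / r ^ n) (fun z hz ↦ ?_)
    (subset_closure (Metric.mem_ball_self hr))
  · rw [hG, Function.update_self] at hmax
    exact (le_div_iff₀ (by positivity)).1 hmax
  · rw [frontier_ball p hr.ne'] at hz
    rw [hG, Function.update_of_ne (Metric.ne_of_mem_sphere hz hr.ne'), norm_div, norm_pow,
      ← dist_eq_norm z p, Metric.mem_sphere.1 hz]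
    gcongr
    exact hM z (Metric.sphere_subset_closedBall hz)

/-- An analytic function that does not vanish identically near `p` has a nonzero leading
Taylor coefficient at `p`. -/
theorem AnalyticAt.exists_tendsto_div_pow {F : ℂ → ℂ} {p : ℂ} (hF : AnalyticAt ℂ F p)
    (h : ¬ ∀ᶠ z in 𝓝 p, F z = 0) :
    ∃ n : ℕ, analyticOrderAt F p = n ∧ ∃ c : ℂ, c ≠ 0 ∧
      Tendsto (fun z ↦ F z / (z - p) ^ n) (𝓝[≠] p) (𝓝 c) := by
  obtain ⟨n, hn⟩ := ENat.ne_top_iff_exists.1 (mt analyticOrderAt_eq_top.1 h)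
  obtain ⟨g, hg, hg0, hgF⟩ := hF.analyticOrderAt_eq_natCast.1 hn.symm
  refine ⟨n, hn.symm, g p, hg0, ?_⟩
  refine (hg.continuousAt.tendsto.mono_left nhdsWithin_le_nhds).congr' ?_
  filter_upwards [hgF.filter_mono nhdsWithin_le_nhds, self_mem_nhdsWithin] with z hz hzp
  have : (z - p) ^ n ≠ 0 := pow_ne_zero _ (sub_ne_zero.2 hzp)
  rw [hz, smul_eq_mul, mul_div_cancel_left₀ _ this]

/-- How the leading Taylor coefficient at a fixed point changes under a weighted composition. -/
theorem tendsto_weighted_comp_div_pow_s6 {f u F : ℂ → ℂ} {p l a c : ℂ} {m n : ℕ}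
    (hf : HasDerivAt f l p) (hl : l ≠ 0) (hfix : f p = p)
    (hu : Tendsto (fun z ↦ u z / (z - p) ^ m) (𝓝[≠] p) (𝓝 a))
    (hF : Tendsto (fun z ↦ F z / (z - p) ^ n) (𝓝[≠] p) (𝓝 c)) :
    Tendsto (fun z ↦ u z * F (f z) / (z - p) ^ (n + m)) (𝓝[≠] p) (𝓝 (a * l ^ n * c)) := by
  have hfp : Tendsto f (𝓝[≠] p) (𝓝[≠] p) := by
    simpa only [hfix] using hf.tendsto_nhdsNE hl
  have hs := hasDerivAt_iff_tendsto_slope.1 hf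
  refine ((hu.mul (hs.pow n)).mul (hF.comp hfp)).congr' ?_
  filter_upwards [self_mem_nhdsWithin, hf.eventually_ne hl (c := p)] with z hz hfz
  have h1 : z - p ≠ 0 := sub_ne_zero.2 hz
  have h2 : f z - p ≠ 0 := sub_ne_zero.2 hfz
  simp only [Function.comp_apply, slope_def_field, hfix, div_pow]
  field_simp
  ring

/-- An infinite-dimensional space of functions analytic at `p` contains nonzero elements of
arbitrarily large order of vanishing at `p`. -/
theorem exists_ne_zero_le_analyticOrderAt {V : Type*} [AddCommGroup V] [Module ℂ V]
    (hV : ¬ FiniteDimensional ℂ V) (ι : V →ₗ[ℂ] (ℂ → ℂ)) {p : ℂ}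
    (hι : ∀ h, AnalyticAt ℂ (ι h) p) (N : ℕ) :
    ∃ h : V, h ≠ 0 ∧ (N : ℕ∞) ≤ analyticOrderAt (ι h) p := by
  let J : V →ₗ[ℂ] (Fin N → ℂ) :=
    { toFun := fun h i ↦ iteratedDeriv i (ι h) p
      map_add' := fun h k ↦ by
        ext i
        simp only [map_add, Pi.add_apply]
        exact iteratedDeriv_add (hι h).contDiffAt (hι k).contDiffAt
      map_smul' := fun c h ↦ by
        ext i
        simp only [map_smul, Pi.smul_apply, RingHom.id_apply]
        exact iteratedDeriv_const_smul (hι h).contDiffAt c }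
  have hJ : ¬ Function.Injective J := fun hi ↦ hV (FiniteDimensional.of_injective J hi)
  rw [injective_iff_map_eq_zero] at hJ
  push Not at hJ
  obtain ⟨h, hh, h0⟩ := hJ
  exact ⟨h, h0, (natCast_le_analyticOrderAt_iff_iteratedDeriv_eq_zero (hι h)).2
    fun i hi ↦ congrFun hh ⟨i, hi⟩⟩

/-- A geometric sequence dominated by another one has the smaller ratio. -/
theorem le_of_forall_mul_pow_le_mul_pow {B D q t : ℝ} (hB : 0 < B) (ht : 0 ≤ t)
    (h : ∀ k : ℕ, B * q ^ k ≤ D * t ^ k) : q ≤ t := by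
  by_contra! hqt
  have hq : 0 < q := ht.trans_lt hqt
  have hlim : Tendsto (fun k : ℕ ↦ D * (t / q) ^ k) atTop (𝓝 (D * 0)) :=
    (tendsto_pow_atTop_nhds_zero_of_lt_one (by positivity)
      ((div_lt_one hq).2 hqt)).const_mul D
  have : B ≤ D * 0 := ge_of_tendsto' hlim fun k ↦ by
    rw [div_pow, ← mul_div_assoc, le_div_iff₀ (by positivity)]
    exact h k
  linarith


/-- if `V` is an infinite-dimensional complex Banach space continuously
included in the holomorphic functions on a nonempty connected open set `U ⊆ ℂ`, and the
weighted composition operator `uC_f` (with `u` not identically zero on `U`) is bounded on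
`V`, then every fixed point `p ∈ U` of `f` satisfies `|f'(p)| ≤ 1`. -/
theorem bounded_weighted_composition_deriv_le_one
    {V : Type*} [NormedAddCommGroup V] [NormedSpace ℂ V] [CompleteSpace V]
    (hV : ¬ FiniteDimensional ℂ V)
    (U : Set ℂ) (hUo : IsOpen U) (hUc : IsConnected U)
    (ι : V →ₗ[ℂ] (ℂ → ℂ))
    (hinj : ∀ h₁ h₂ : V, Set.EqOn (ι h₁) (ι h₂) U → h₁ = h₂)
    (hhol : ∀ h : V, DifferentiableOn ℂ (ι h) U)
    (hbd : ∀ K : Set ℂ, K ⊆ U → IsCompact K →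
      ∃ C : ℝ, 0 ≤ C ∧ ∀ h : V, ∀ z ∈ K, ‖ι h z‖ ≤ C * ‖h‖)
    (f : ℂ → ℂ) (hf : DifferentiableOn ℂ f U) (hfU : Set.MapsTo f U U)
    (u : ℂ → ℂ) (hu : DifferentiableOn ℂ u U) (hu0 : ∃ z ∈ U, u z ≠ 0)
    (T : V →L[ℂ] V) (hT : ∀ h : V, ∀ z ∈ U, ι (T h) z = u z * ι h (f z))
    (p : ℂ) (hp : p ∈ U) (hfix : f p = p) :
    ‖deriv f p‖ ≤ 1 := by
  have : Nontrivial V := not_subsingleton_iff_nontrivial.1 fun _ ↦ hV inferInstance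
  by_contra! hl
  set l := deriv f p with hl_def
  have hl0 : l ≠ 0 := norm_pos_iff.1 (one_pos.trans hl)
  have hpU : U ∈ 𝓝 p := hUo.mem_nhds hp
  have hfd : HasDerivAt f l p := (hf.differentiableAt hpU).hasDerivAt
  have han : ∀ h : V, AnalyticAt ℂ (ι h) p := fun h ↦ (hhol h).analyticAt hpU
  have hne : ∀ F : ℂ → ℂ, DifferentiableOn ℂ F U → (∀ᶠ z in 𝓝 p, F z = 0) → EqOn F 0 U :=
    fun F hF h0 ↦ (hF.analyticOnNhd hUo).eqOn_zero_of_preconnected_of_eventuallyEq_zero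
      hUc.isPreconnected hp h0
  obtain ⟨m, -, a, ha, hua⟩ := (hu.analyticAt hpU).exists_tendsto_div_pow fun h0 ↦ by
    obtain ⟨z, hz, huz⟩ := hu0
    exact huz (hne u hu h0 hz)
  obtain ⟨r, hr, hrU⟩ := Metric.nhds_basis_closedBall.mem_iff.1 hpU
  obtain ⟨C, hC0, hC⟩ := hbd _ hrU (isCompact_closedBall p r)
  have key : ∀ (h : V) (n : ℕ) (c : ℂ), c ≠ 0 →
      Tendsto (fun z ↦ ι h z / (z - p) ^ n) (𝓝[≠] p) (𝓝 c) →
      ‖a‖ * ‖l‖ ^ n * r ^ m ≤ ‖T‖ := by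
    intro h n c hc hlim
    have hiter : ∀ k : ℕ, ∃ d : ℂ, ‖c‖ * (‖a‖ * ‖l‖ ^ n) ^ k ≤ ‖d‖ ∧
        Tendsto (fun z ↦ ι ((T ^ k) h) z / (z - p) ^ (n + k * m)) (𝓝[≠] p) (𝓝 d) := by
      intro k
      induction k with
      | zero => exact ⟨c, by simp, by simpa using hlim⟩
      | succ k ih =>
        obtain ⟨d, hd, hdlim⟩ := ih
        refine ⟨a * l ^ (n + k * m) * d, ?_, ?_⟩
        · rw [norm_mul, norm_mul, norm_pow]
          calc ‖c‖ * (‖a‖ * ‖l‖ ^ n) ^ (k + 1)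
              = ‖a‖ * ‖l‖ ^ n * (‖c‖ * (‖a‖ * ‖l‖ ^ n) ^ k) := by ring
            _ ≤ ‖a‖ * ‖l‖ ^ (n + k * m) * ‖d‖ := by
              gcongr
              · exact hl.le
              · exact Nat.le_add_right _ _
        · refine (tendsto_weighted_comp_div_pow_s6 hfd hl0 hfix hua hdlim).congr' ?_
          filter_upwards [nhdsWithin_le_nhds hpU] with z hz
          rw [pow_succ' T, mul_apply_eq_comp, hT _ z hz, add_one_mul, add_assoc]
    refine le_of_forall_mul_pow_le_mul_pow (B := ‖c‖ * r ^ n) (D := C * ‖h‖)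
      (by positivity) (norm_nonneg T) fun k ↦ ?_
    obtain ⟨d, hd, hdlim⟩ := hiter k
    have hTk : ‖(T ^ k) h‖ ≤ ‖T‖ ^ k * ‖h‖ :=
      ((T ^ k).le_opNorm h).trans (by gcongr; exact norm_pow_le T k)
    calc ‖c‖ * r ^ n * (‖a‖ * ‖l‖ ^ n * r ^ m) ^ k
        = ‖c‖ * (‖a‖ * ‖l‖ ^ n) ^ k * r ^ (n + k * m) := by ring
      _ ≤ ‖d‖ * r ^ (n + k * m) := by gcongr
      _ ≤ C * ‖(T ^ k) h‖ :=
        norm_leadingCoeff_mul_pow_le hUo (hhol _) hr hrU hdlim (hC _)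
      _ ≤ C * (‖T‖ ^ k * ‖h‖) := by gcongr
      _ = C * ‖h‖ * ‖T‖ ^ k := by ring
  obtain ⟨N, hN⟩ := pow_unbounded_of_one_lt (‖T‖ / (‖a‖ * r ^ m)) hl
  obtain ⟨h, h0, hord⟩ := exists_ne_zero_le_analyticOrderAt hV ι han N
  obtain ⟨n, hn, c, hc, hlim⟩ := (han h).exists_tendsto_div_pow fun hz ↦
    h0 (hinj h 0 (by simpa using hne _ (hhol h) hz))
  rw [hn, Nat.cast_le] at hord
  have hpos : 0 < ‖a‖ * r ^ m := by positivity
  have hlt : ‖T‖ < ‖l‖ ^ n * (‖a‖ * r ^ m) :=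
    (div_lt_iff₀ hpos).1 (hN.trans_le (pow_le_pow_right₀ hl.le hord))
  have hle := key h n c hc hlim
  linarith [hle, hlt, show ‖a‖ * ‖l‖ ^ n * r ^ m = ‖l‖ ^ n * (‖a‖ * r ^ m) by ring]
end
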